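/- For α, β, γ, δ ∈ D^* with αδ − βγ ∈ D^×, let B(α,β,γ,δ) be the algebra on D² with natural basis {e₁,e₂} and multiplication e₁² = αe₁ + βe₂, e₂² = γe₁ + δe₂, e₁e₂ = e₂e₁ = 0. For α, β, γ, δ, α', β', γ', δ' ∈ D^* with αδ − βγ ∈ D^× and α'δ' − β'γ' ∈ D^×, the algebras B(α,β,γ,δ) and B(α',β',γ',δ') are isomorphic if and only if there exist units k₁, k₂ ∈ D^× such that either (α',β',γ',δ') = (k₁α, k₁²k₂⁻¹β, k₂²k₁⁻¹γ, k₂δ) or (α',β',γ',δ') = (k₁δ, k₁²k₂⁻¹γ, k₂²k₁⁻¹β, k₂α). -/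

import Mathlib

/-- The two-dimensional evolution algebra multiplication on `D × D` with natural basis
`e₁ = (1,0)`, `e₂ = (0,1)` determined by `e₁² = a•e₁ + b•e₂`, `e₂² = c•e₁ + d•e₂` and
`e₁e₂ = e₂e₁ = 0`. -/
def evMul {D : Type*} [CommRing D] (a b c d : D) (x y : D × D) : D × D :=
  (a * (x.1 * y.1) + c * (x.2 * y.2), b * (x.1 * y.1) + d * (x.2 * y.2))

/-- Two such evolution algebras are isomorphic if there is a bijective `D`-linear map
`D × D → D × D` preserving the multiplications. -/
def EvIso {D : Type*} [CommRing D] (a b c d a' b' c' d' : D) : Prop :=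
  ∃ f : (D × D) ≃ₗ[D] (D × D),
    ∀ x y : D × D, f (evMul a b c d x y) = evMul a' b' c' d' (f x) (f y)

theorem coords_mul_eq_zero_of_evMul_eq_zero {D : Type*} [CommRing D] [IsDomain D] {a b c d : D}
    (h : IsUnit (a * d - b * c)) {x y : D × D} (hxy : evMul a b c d x y = 0) :
    x.1 * y.1 = 0 ∧ x.2 * y.2 = 0 := by
  obtain ⟨h₁, h₂⟩ := Prod.ext_iff.mp hxy
  simp only [evMul, Prod.fst_zero, Prod.snd_zero] at h₁ h₂
  constructor <;> refine (mul_eq_zero.mp ?_).resolve_left h.ne_zero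
  · linear_combination d * h₁ - c * h₂
  · linear_combination a * h₂ - b * h₁

/-- A linear endomorphism of `D × D` acts on coordinates through the images of the basis. -/
theorem LinearMap.apply_prod_self {D : Type*} [CommRing D] (f : (D × D) →ₗ[D] (D × D))
    (x : D × D) :
    f x = (x.1 * (f (1, 0)).1 + x.2 * (f (0, 1)).1, x.1 * (f (1, 0)).2 + x.2 * (f (0, 1)).2) := by
  have hx : x = x.1 • ((1, 0) : D × D) + x.2 • ((0, 1) : D × D) := by ext <;> simp
  conv_lhs => rw [hx, map_add, map_smul, map_smul]
  ext <;> simp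

/-- If the columns of an automorphism of `D × D` have disjoint supports, it is monomial. -/
theorem LinearEquiv.exists_units_of_disjoint_columns {D : Type*} [CommRing D] [IsDomain D]
    (f : (D × D) ≃ₗ[D] (D × D)) (h₁ : (f (1, 0)).1 * (f (0, 1)).1 = 0)
    (h₂ : (f (1, 0)).2 * (f (0, 1)).2 = 0) :
    ∃ u v : Dˣ, (f (1, 0) = ((u : D), 0) ∧ f (0, 1) = (0, (v : D))) ∨
      (f (1, 0) = (0, (u : D)) ∧ f (0, 1) = ((v : D), 0)) := by
  have e₁ := LinearMap.apply_prod_self f.toLinearMap (f.symm (1, 0))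
  have e₂ := LinearMap.apply_prod_self f.toLinearMap (f.symm (0, 1))
  simp only [LinearEquiv.coe_coe, LinearEquiv.apply_symm_apply, Prod.mk.injEq] at e₁ e₂
  generalize f.symm (1, 0) = x at e₁
  generalize f.symm (0, 1) = y at e₂
  generalize f (1, 0) = p at *
  generalize f (0, 1) = q at *
  obtain ⟨p₁, p₂⟩ := p
  obtain ⟨q₁, q₂⟩ := q
  simp only at h₁ h₂ e₁ e₂
  obtain ⟨e₁, -⟩ := e₁
  obtain ⟨e₂, e₃⟩ := e₂
  rcases mul_eq_zero.mp h₁ with rfl | rfl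
  · have hq : q₁ * x.2 = 1 := by linear_combination -e₁
    have hy : y.2 = 0 := by linear_combination (-y.2) * hq - x.2 * e₂
    have hp : p₂ * y.1 = 1 := by linear_combination -e₃ - q₂ * hy
    have hs : q₂ = 0 := by linear_combination (-q₂) * hp + y.1 * h₂
    exact ⟨.mkOfMulEqOne _ _ hp, .mkOfMulEqOne _ _ hq, .inr ⟨rfl, by rw [hs]; rfl⟩⟩
  · have hp : p₁ * x.1 = 1 := by linear_combination -e₁
    have hy : y.1 = 0 := by linear_combination (-y.1) * hp - x.1 * e₂
    have hq : q₂ * y.2 = 1 := by linear_combination -e₃ - p₂ * hy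
    have hs : p₂ = 0 := by linear_combination (-p₂) * hq + y.2 * h₂
    exact ⟨.mkOfMulEqOne _ _ hp, .mkOfMulEqOne _ _ hq, .inl ⟨by rw [hs]; rfl, rfl⟩⟩

/-- The automorphism of `D × D` scaling the two coordinates by units. -/
def diagEquiv {D : Type*} [CommRing D] (u v : Dˣ) : (D × D) ≃ₗ[D] (D × D) :=
  (LinearEquiv.smulOfUnit u).prodCongr (LinearEquiv.smulOfUnit v)

theorem diagEquiv_apply {D : Type*} [CommRing D] (u v : Dˣ) (x : D × D) :
    diagEquiv u v x = ((u : D) * x.1, (v : D) * x.2) :=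
  rfl

theorem evIso_of_diag {D : Type*} [CommRing D] (a b c d : D) (k l : Dˣ) :
    EvIso a b c d ((k : D) * a) ((k : D) ^ 2 * (↑l⁻¹ : D) * b)
      ((l : D) ^ 2 * (↑k⁻¹ : D) * c) ((l : D) * d) := by
  refine ⟨diagEquiv k⁻¹ l⁻¹, fun x y => ?_⟩
  have hk := k.mul_inv
  have hl := l.mul_inv
  simp only [diagEquiv_apply, evMul, Prod.mk.injEq]
  generalize (↑k⁻¹ : D) = k' at *
  generalize (↑l⁻¹ : D) = l' at *
  constructor
  · linear_combination (-(a * k' * x.1 * y.1)) * hk -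
      k' * c * x.2 * y.2 * (l * l' + 1) * hl
  · linear_combination (-(d * l' * x.2 * y.2)) * hl -
      l' * b * x.1 * y.1 * (k * k' + 1) * hk

theorem swap_evMul {D : Type*} [CommRing D] (a b c d : D) (x y : D × D) :
    LinearEquiv.prodComm D D D (evMul a b c d x y) =
      evMul d c b a (LinearEquiv.prodComm D D D x) (LinearEquiv.prodComm D D D y) := by
  simp only [evMul, LinearEquiv.prodComm_apply, Prod.swap, Prod.mk.injEq]
  constructor <;> ring

theorem evIso_swap {D : Type*} [CommRing D] (a b c d : D) : EvIso a b c d d c b a :=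
  ⟨LinearEquiv.prodComm D D D, swap_evMul a b c d⟩

theorem EvIso.trans {D : Type*} [CommRing D] {a b c d a' b' c' d' a'' b'' c'' d'' : D}
    (h : EvIso a b c d a' b' c' d') (h' : EvIso a' b' c' d' a'' b'' c'' d'') :
    EvIso a b c d a'' b'' c'' d'' := by
  obtain ⟨f, hf⟩ := h
  obtain ⟨g, hg⟩ := h'
  exact ⟨f.trans g, fun x y => by simp only [LinearEquiv.trans_apply, hf, hg]⟩

/-- An isomorphism scaling the basis vectors relates the structure constants by units. -/
theorem structure_constants_of_diag {D : Type*} [CommRing D] {a b c d a' b' c' d' : D}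
    {f : (D × D) →ₗ[D] (D × D)}
    (hf : ∀ x y : D × D, f (evMul a b c d x y) = evMul a' b' c' d' (f x) (f y))
    {u v : Dˣ} (h₁ : f (1, 0) = ((u : D), 0)) (h₂ : f (0, 1) = (0, (v : D))) :
    a' = (↑u⁻¹ : D) * a ∧ b' = (↑u⁻¹ : D) ^ 2 * v * b ∧
      c' = (↑v⁻¹ : D) ^ 2 * u * c ∧ d' = (↑v⁻¹ : D) * d := by
  have e₁ := hf (1, 0) (1, 0)
  have e₂ := hf (0, 1) (0, 1)
  rw [LinearMap.apply_prod_self f] at e₁ e₂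
  simp only [evMul, h₁, h₂, Prod.mk.injEq] at e₁ e₂
  have hu := u.mul_inv
  have hv := v.mul_inv
  obtain ⟨e₁, e₃⟩ := e₁
  obtain ⟨e₂, e₄⟩ := e₂
  generalize (↑u⁻¹ : D) = u' at *
  generalize (↑v⁻¹ : D) = v' at *
  refine ⟨?_, ?_, ?_, ?_⟩
  · linear_combination (-(u' ^ 2)) * e₁ + (u' * a - a' * (u * u' + 1)) * hu
  · linear_combination (-(u' ^ 2)) * e₃ - b' * (u * u' + 1) * hu
  · linear_combination (-(v' ^ 2)) * e₂ - c' * (v * v' + 1) * hv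
  · linear_combination (-(v' ^ 2)) * e₄ + (v' * d - d' * (v * v' + 1)) * hv

/-- For `α, β, γ, δ ∈ D^*` with `αδ - βγ ∈ D^×`, `B(α,β,γ,δ)` has `e₁² = αe₁ + βe₂`,
`e₂² = γe₁ + δe₂`.  `B(α,β,γ,δ) ≅ B(α',β',γ',δ')` iff there are units `k₁, k₂ ∈ D^×` with
`(α',β',γ',δ') = (k₁α, k₁²k₂⁻¹β, k₂²k₁⁻¹γ, k₂δ)` or
`(α',β',γ',δ') = (k₁δ, k₁²k₂⁻¹γ, k₂²k₁⁻¹β, k₂α)`. -/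
theorem stmt19 {D : Type*} [CommRing D] [IsDomain D] (α β γ δ α' β' γ' δ' : D)
    (hα : α ≠ 0) (hβ : β ≠ 0) (hγ : γ ≠ 0) (hδ : δ ≠ 0)
    (hα' : α' ≠ 0) (hβ' : β' ≠ 0) (hγ' : γ' ≠ 0) (hδ' : δ' ≠ 0)
    (h : IsUnit (α * δ - β * γ)) (h' : IsUnit (α' * δ' - β' * γ')) :
    EvIso α β γ δ α' β' γ' δ' ↔
      ∃ k₁ k₂ : Dˣ,
        (α' = (k₁ : D) * α ∧ β' = (k₁ : D) ^ 2 * (↑k₂⁻¹ : D) * β ∧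
          γ' = (k₂ : D) ^ 2 * (↑k₁⁻¹ : D) * γ ∧ δ' = (k₂ : D) * δ) ∨
        (α' = (k₁ : D) * δ ∧ β' = (k₁ : D) ^ 2 * (↑k₂⁻¹ : D) * γ ∧
          γ' = (k₂ : D) ^ 2 * (↑k₁⁻¹ : D) * β ∧ δ' = (k₂ : D) * α) := by
  constructor
  · rintro ⟨f, hf⟩
    have h₀ := hf (1, 0) (0, 1)
    rw [show evMul α β γ δ (1, 0) (0, 1) = 0 by simp [evMul], map_zero] at h₀
    obtain ⟨h₁, h₂⟩ := coords_mul_eq_zero_of_evMul_eq_zero h' h₀.symm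
    obtain ⟨u, v, ⟨hu, hv⟩ | ⟨hu, hv⟩⟩ := f.exists_units_of_disjoint_columns h₁ h₂
    · refine ⟨u⁻¹, v⁻¹, .inl ?_⟩
      simpa only [inv_inv] using structure_constants_of_diag (f := f.toLinearMap) hf hu hv
    · refine ⟨v⁻¹, u⁻¹, .inr ?_⟩
      simpa only [inv_inv] using structure_constants_of_diag (u := v) (v := u)
        (f := f.toLinearMap ∘ₗ (LinearEquiv.prodComm D D D).toLinearMap)
        (fun x y => by
          simp only [LinearMap.comp_apply, LinearEquiv.coe_coe, swap_evMul, hf]) hv hu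
  · rintro ⟨k, l, ⟨rfl, rfl, rfl, rfl⟩ | ⟨rfl, rfl, rfl, rfl⟩⟩
    · exact evIso_of_diag α β γ δ k l
    · exact (evIso_swap α β γ δ).trans (evIso_of_diag δ γ β α k l)
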